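/- Let p be an odd prime, ν a positive integer, and a a nonzero integer with α := ord_p(a) satisfying 0 ≤ α < ν. Let b be an integer divisible by p^α. Then G(a,b;p^ν) = p^{(α+ν)/2} · ε_{p^{ν−α}} · ( (a/p^α) / p^{ν−α} ) · e^{−2πi b² c₀ / p^{ν+α}}, where ( · / p^{ν−α} ) is the Jacobi symbol, and c₀ is any integer with 4·(a/p^α)·c₀ ≡ 1 (mod p^{ν+α}) (the value e^{−2πi b² c₀ / p^{ν+α}} is independent of the choice of such c₀). -/

import Mathlib

/-- The generalized Gauss sum `G(a,b;c) = ∑_{n mod c} e^{2πi(an² + bn)/c}`,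
with the sum taken over the complete residue system `{0, 1, …, c-1}`. -/
noncomputable def gaussSumG (a b : ℤ) (c : ℕ) : ℂ :=
  ∑ n ∈ Finset.range c,
    Complex.exp (2 * Real.pi * Complex.I * (((a * n ^ 2 + b * n : ℤ) : ℂ) / (c : ℂ)))

/-- For an odd natural number `j`, `ε_j = 1` if `j ≡ 1 (mod 4)` and `ε_j = i`
if `j ≡ 3 (mod 4)`. -/
noncomputable def epsFactor (j : ℕ) : ℂ := if j % 4 = 1 then 1 else Complex.I

open Finset Polynomial

lemma auxA (p : ℕ) [Fact p.Prime] (i : ℕ) (hi : i ≤ p - 1) :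
    ∃ Q : (ZMod p)[X], ∑ j ∈ range p, C ((j : ZMod p) ^ i) * X ^ j = (X - 1) ^ (p - 1 - i) * Q ∧
      Q.eval 1 = (-1) ^ i * (i.factorial : ZMod p) := by
  induction i with
  | zero =>
    refine ⟨1, ?_, by simp⟩
    have hp : p.Prime := Fact.out
    have h1 : (∑ j ∈ range p, (X : (ZMod p)[X]) ^ j) * (X - 1) = (X - 1) ^ (p - 1) * (X - 1) := by
      rw [geom_sum_mul, ← pow_succ, Nat.sub_add_cancel hp.one_le, sub_pow_char, one_pow]
    have h2 : (X - 1 : (ZMod p)[X]) ≠ 0 := by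
      simpa using X_sub_C_ne_zero (1 : ZMod p)
    simpa using mul_right_cancel₀ h2 h1
  | succ i ih =>
    obtain ⟨Q, hQ, hQ1⟩ := ih (by omega)
    obtain ⟨e, he⟩ : ∃ e, p - 1 - i = e + 1 := ⟨p - 1 - i - 1, by omega⟩
    have he' : p - 1 - (i + 1) = e := by omega
    have hp : p.Prime := Fact.out
    refine ⟨X * ((e + 1 : (ZMod p)[X]) * Q + (X - 1) * derivative Q), ?_, ?_⟩
    · have := congrArg (fun P => X * derivative P) hQ
      rw [he'] 
      rw [he] at this
      simp only [derivative_sum, derivative_mul, derivative_C, mul_sum,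
        derivative_pow, derivative_sub, derivative_X, derivative_one] at this
      trans X * ((C ((e + 1 : ℕ) : ZMod p) * (X - 1) ^ (e + 1 - 1) * (1 - 0)) * Q +
        (X - 1) ^ (e + 1) * derivative Q)
      · rw [← this]
        refine sum_congr rfl fun j _ => ?_
        rcases j with _ | j
        · simp
        · simp only [Nat.add_sub_cancel, pow_succ, map_mul]
          simp
          ring
      · simp [pow_succ]
        ring
    · have : ((e : ZMod p) + 1) = - ((i : ZMod p) + 1) := by
        have h : ((e + 1 + (i + 1) : ℕ) : ZMod p) = 0 := by
          have : e + 1 + (i + 1) = p := by have := hp.one_le; omega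
          rw [this]; simp
        push_cast at h
        linear_combination h
      simp [hQ1, this, Nat.factorial_succ, pow_succ]
      ring

lemma auxB (p : ℕ) [Fact p.Prime] (m : ℕ) (hm : m ≤ p) :
    ∃ R : (ZMod p)[X], ∏ j ∈ range m, (X ^ (j + 1) - X ^ (p - (j + 1))) = (X - 1) ^ m * R ∧
      R.eval 1 = 2 ^ m * (m.factorial : ZMod p) := by
  induction m with
  | zero => exact ⟨1, by simp⟩
  | succ m ih =>
    obtain ⟨R, hR, hR1⟩ := ih (by omega)
    refine ⟨R * ((∑ i ∈ range (m + 1), X ^ i) - ∑ i ∈ range (p - (m + 1)), X ^ i), ?_, ?_⟩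
    · rw [prod_range_succ, hR]
      have h1 := geom_sum_mul (X : (ZMod p)[X]) (m + 1)
      have h2 := geom_sum_mul (X : (ZMod p)[X]) (p - (m + 1))
      rw [pow_succ (X - 1)]
      linear_combination (X - 1) ^ m * R * (h2 - h1)
    · simp only [eval_mul, hR1, eval_sub, eval_finsetSum, eval_pow, eval_X, one_pow, sum_const,
        card_range, nsmul_eq_mul, mul_one, Nat.cast_sub hm, Nat.factorial_succ, CharP.cast_eq_zero]
      push_cast
      ring

/-- Key congruence. -/
lemma auxC (p : ℕ) [Fact p.Prime] (hp2 : p ≠ 2) (ζ : ℂ) (hζ : IsPrimitiveRoot ζ p) (s : ℤ)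
    (h : ∑ j ∈ range p, (legendreSym p j : ℂ) * ζ ^ j =
      s * ∏ j ∈ range (p / 2), (ζ ^ (j + 1) - ζ ^ (p - (j + 1)))) :
    (s : ZMod p) * (-2) ^ (p / 2) = 1 := by
  have hp : p.Prime := Fact.out
  have hodd : p % 2 = 1 := hp.eq_two_or_odd.resolve_left hp2
  set m := p / 2 with hm
  have hpm : p = 2 * m + 1 := by omega
  have hm1 : 1 ≤ m := by have := hp.two_le; omega
  let P : ℤ[X] := ∑ j ∈ range p, C (legendreSym p j) * X ^ j -
    C s * ∏ j ∈ range m, (X ^ (j + 1) - X ^ (p - (j + 1)))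
  have hP : aeval ζ P = 0 := by
    simp only [P, map_sub, map_sum, map_mul, map_prod, map_pow, aeval_X, aeval_C]
    simp [h]
  have hdvd : cyclotomic p ℤ ∣ P := by
    rw [cyclotomic_eq_minpoly hζ hp.pos]
    exact minpoly.isIntegrallyClosed_dvd (hζ.isIntegral hp.pos) hP
  have hdvd2 := Polynomial.map_dvd (Int.castRingHom (ZMod p)) hdvd
  have hcyc : cyclotomic p (ZMod p) = (X - 1) ^ (p - 1) := by
    obtain ⟨Q, hQ, -⟩ := auxA p 0 (by omega)
    have h1 : (∑ j ∈ range p, (X : (ZMod p)[X]) ^ j) * (X - 1) = (X - 1) ^ (p - 1) * (X - 1) := by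
      rw [geom_sum_mul, ← pow_succ, Nat.sub_add_cancel hp.one_le, sub_pow_char, one_pow]
    have h2 : (X - 1 : (ZMod p)[X]) ≠ 0 := by
      simpa using X_sub_C_ne_zero (1 : ZMod p)
    rw [cyclotomic_prime]
    exact mul_right_cancel₀ h2 h1
  rw [map_cyclotomic, hcyc] at hdvd2
  obtain ⟨Q, hQ, hQ1⟩ := auxA p m (by omega)
  obtain ⟨R, hR, hR1⟩ := auxB p m (by omega)
  have hmap : P.map (Int.castRingHom (ZMod p)) = (X - 1) ^ m * (Q - C (s : ZMod p) * R) := by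
    have h3 : p - 1 - m = m := by omega
    rw [h3] at hQ
    simp only [P, Polynomial.map_sub, Polynomial.map_sum, Polynomial.map_mul, Polynomial.map_prod,
      Polynomial.map_pow, map_X, map_C]
    rw [hR]
    have : ∀ j : ℕ, (Int.castRingHom (ZMod p)) (legendreSym p j) = (j : ZMod p) ^ m := by
      intro j
      simp [legendreSym.eq_pow, hm]
    simp only [this, hQ]
    simp
    ring
  rw [hmap] at hdvd2
  have h4 : (X - 1 : (ZMod p)[X]) ^ m * (X - 1) ∣ (X - 1) ^ m * (Q - C (s : ZMod p) * R) := by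
    refine dvd_trans ?_ hdvd2
    rw [← pow_succ]
    exact pow_dvd_pow _ (by omega)
  have h2 : (X - 1 : (ZMod p)[X]) ≠ 0 := by
    simpa using X_sub_C_ne_zero (1 : ZMod p)
  have h5 := (mul_dvd_mul_iff_left (pow_ne_zero m h2)).1 h4
  have h6 : eval 1 (Q - C (s : ZMod p) * R) = 0 := by
    obtain ⟨T, hT⟩ := h5
    rw [hT]; simp
  simp only [eval_sub, eval_mul, eval_C, hQ1, hR1] at h6
  have hf : (m.factorial : ZMod p) ≠ 0 := by
    rw [Ne, ZMod.natCast_eq_zero_iff, hp.dvd_factorial]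
    omega
  have h7 : (-1 : ZMod p) ^ m = s * 2 ^ m := by
    apply mul_right_cancel₀ hf
    linear_combination h6
  rw [neg_pow, mul_left_comm, ← h7, ← mul_pow]
  simp

lemma sumZ (N : ℕ) [NeZero N] (F : ZMod N → ℂ) :
    ∑ x : ZMod N, F x = ∑ j ∈ range N, F (j : ZMod N) := by
  symm
  refine sum_bij (fun j _ => (j : ZMod N)) (by simp) ?_ ?_ (by simp)
  · intro a ha b hb hab
    rw [mem_range] at ha hb
    have := congrArg ZMod.val hab
    simpa [ZMod.val_natCast, Nat.mod_eq_of_lt ha, Nat.mod_eq_of_lt hb] using this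
  · intro x _
    exact ⟨x.val, by simpa using x.val_lt, by simp⟩

lemma gsq (p : ℕ) [Fact p.Prime] (hp2 : p ≠ 2) :
    (∑ j ∈ range p, (legendreSym p j : ℂ) * (ZMod.stdAddChar (j : ZMod p) : ℂ)) ^ 2 =
      (-1) ^ (p / 2) * p := by
  have hp : p.Prime := Fact.out
  have hodd : p % 2 = 1 := hp.eq_two_or_odd.resolve_left hp2
  have hc : ringChar (ZMod p) ≠ 2 := by rwa [ZMod.ringChar_zmod_n]
  have h := gaussSum_sq (R := ZMod p) (R' := ℂ)
    (χ := (quadraticChar (ZMod p)).ringHomComp (Int.castRingHom ℂ))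
    ((MulChar.ringHomComp_ne_one_iff (RingHom.injective_int _)).mpr (quadraticChar_ne_one hc))
    ((quadraticChar_isQuadratic (ZMod p)).comp _) (ZMod.isPrimitive_stdAddChar p)
  rw [gaussSum, sumZ] at h
  simp only [MulChar.ringHomComp_apply, quadraticChar_neg_one hc, ZMod.card,
    ZMod.χ₄_eq_neg_one_pow hodd] at h
  simpa [legendreSym] using h

lemma prodsq (p : ℕ) [Fact p.Prime] (hp2 : p ≠ 2) (ζ : ℂ) (hζ : IsPrimitiveRoot ζ p) :
    (∏ j ∈ range (p / 2), (ζ ^ (j + 1) - ζ ^ (p - (j + 1)))) ^ 2 = (-1) ^ (p / 2) * p := by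
  have hp : p.Prime := Fact.out
  have hodd : p % 2 = 1 := hp.eq_two_or_odd.resolve_left hp2
  set m := p / 2 with hm
  have hpm : p = 2 * m + 1 := by omega
  have h2 : IsPrimitiveRoot (ζ ^ 2) (2 * m + 1) := by
    rw [← hpm]
    refine hζ.pow_of_coprime 2 ?_
    exact (Nat.coprime_primes Nat.prime_two hp).2 (Ne.symm hp2)
  have h3 := h2.prod_one_sub_pow_eq_order
  rw [two_mul m, prod_range_add, ← prod_range_reflect (fun x => 1 - (ζ ^ 2) ^ (m + x + 1)),
    ← prod_mul_distrib] at h3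
  have h4 : ∀ j ∈ range m, (1 - (ζ ^ 2) ^ (j + 1)) * (1 - (ζ ^ 2) ^ (m + (m - 1 - j) + 1)) =
      (-1) * (ζ ^ (j + 1) - ζ ^ (p - (j + 1))) ^ 2 := by
    intro j hj
    rw [mem_range] at hj
    have e1 : m + (m - 1 - j) + 1 = p - (j + 1) := by omega
    have e2 : ζ ^ (j + 1) * ζ ^ (p - (j + 1)) = 1 := by
      rw [← pow_add, Nat.add_sub_cancel' (by omega), hζ.pow_eq_one]
    rw [e1, ← pow_mul, ← pow_mul, mul_comm 2, mul_comm 2, pow_mul, pow_mul]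
    linear_combination (ζ ^ (j + 1) * ζ ^ (p - (j + 1)) - 1) * e2
  rw [prod_congr rfl h4, prod_mul_distrib, prod_pow] at h3
  simp only [prod_const, card_range] at h3
  have h5 : ((-1 : ℂ) ^ m) * (-1) ^ m = 1 := by rw [← mul_pow]; simp
  have h6 : (p : ℂ) = m + m + 1 := by rw [hpm]; push_cast; ring
  push_cast at h3
  rw [h6, ← h3, ← mul_assoc, h5, one_mul]

lemma prodval (p : ℕ) [Fact p.Prime] (hp2 : p ≠ 2) :
    ∏ j ∈ range (p / 2), (Complex.exp (2 * Real.pi * Complex.I / p) ^ (j + 1) -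
      Complex.exp (2 * Real.pi * Complex.I / p) ^ (p - (j + 1))) =
      Complex.I ^ (p / 2) * (Real.sqrt p : ℂ) := by
  have hp : p.Prime := Fact.out
  have hodd : p % 2 = 1 := hp.eq_two_or_odd.resolve_left hp2
  have hp0 : (p : ℂ) ≠ 0 := by exact_mod_cast hp.ne_zero
  have hpr : (0 : ℝ) < p := by exact_mod_cast hp.pos
  have hζ := Complex.isPrimitiveRoot_exp p hp.ne_zero
  have hsq := prodsq p hp2 _ hζ
  set ζ := Complex.exp (2 * Real.pi * Complex.I / p) with hζd
  have h1 : ∀ j ∈ range (p / 2), ζ ^ (j + 1) - ζ ^ (p - (j + 1)) =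
      Complex.I * ((2 * Real.sin (2 * Real.pi * (j + 1) / p) : ℝ) : ℂ) := by
    intro j hj
    rw [mem_range] at hj
    have e2 : ζ ^ (p - (j + 1)) = (ζ ^ (j + 1))⁻¹ := by
      apply eq_inv_of_mul_eq_one_left
      rw [← pow_add, Nat.sub_add_cancel (by omega), hζ.pow_eq_one]
    have e1 : ζ ^ (j + 1) = Complex.exp ((2 * Real.pi * (j + 1) / p : ℂ) * Complex.I) := by
      rw [hζd, ← Complex.exp_nat_mul]
      congr 1
      push_cast
      ring
    rw [e2, e1, ← Complex.exp_neg]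
    push_cast
    rw [Complex.sin, neg_mul]
    linear_combination (Complex.exp (2 * Real.pi * (j + 1) / p * Complex.I) -
      Complex.exp (-(2 * Real.pi * (j + 1) / p * Complex.I))) * Complex.I_sq
  rw [prod_congr rfl h1, prod_mul_distrib, prod_const, card_range, ← Complex.ofReal_prod] at hsq ⊢
  set R := ∏ j ∈ range (p / 2), (2 * Real.sin (2 * Real.pi * (j + 1) / p)) with hR
  have hRpos : 0 < R := by
    refine prod_pos fun j hj => mul_pos two_pos (Real.sin_pos_of_pos_of_lt_pi (by positivity) ?_)
    rw [mem_range] at hj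
    rw [div_lt_iff₀ hpr]
    have : (2 * (j + 1) : ℝ) < p := by
      have : 2 * (j + 1) < p := by omega
      exact_mod_cast this
    nlinarith [Real.pi_pos]
  have hR2 : R ^ 2 = p := by
    have : (R : ℂ) ^ 2 = p := by
      rw [mul_pow, ← pow_mul, mul_comm (p / 2) 2, pow_mul, Complex.I_sq] at hsq
      exact mul_left_cancel₀ (pow_ne_zero _ (by norm_num)) hsq
    exact_mod_cast this
  rw [← hR2, Real.sqrt_sq hRpos.le]

lemma gval (p : ℕ) [Fact p.Prime] (hp2 : p ≠ 2) :
    ∑ j ∈ range p, (legendreSym p j : ℂ) * (ZMod.stdAddChar (j : ZMod p) : ℂ) =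
      epsFactor p * (Real.sqrt p : ℂ) := by
  have hp : p.Prime := Fact.out
  have hodd : p % 2 = 1 := hp.eq_two_or_odd.resolve_left hp2
  have hζ := Complex.isPrimitiveRoot_exp p hp.ne_zero
  have hpsq := prodsq p hp2 _ hζ
  have hgsq := gsq p hp2
  have hpv := prodval p hp2
  have hC := auxC p hp2 _ hζ
  set ζ := Complex.exp (2 * Real.pi * Complex.I / p) with hζd
  have hst : ∀ j : ℕ, (ZMod.stdAddChar (j : ZMod p) : ℂ) = ζ ^ j := by
    intro j
    have := ZMod.stdAddChar_coe (N := p) (j : ℤ)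
    rw [Int.cast_natCast] at this
    rw [this, hζd, ← Complex.exp_nat_mul]
    congr 1
    push_cast
    ring
  simp only [hst] at hgsq ⊢
  set g := ∑ j ∈ range p, (legendreSym p j : ℂ) * ζ ^ j with hg
  set Q := ∏ j ∈ range (p / 2), (ζ ^ (j + 1) - ζ ^ (p - (j + 1))) with hQ
  have hs : ∃ s : ℤ, (s = 1 ∨ s = -1) ∧ g = s * Q := by
    rcases sq_eq_sq_iff_eq_or_eq_neg.1 (hgsq.trans hpsq.symm) with h | h
    · exact ⟨1, Or.inl rfl, by simpa using h⟩
    · exact ⟨-1, Or.inr rfl, by simpa using h⟩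
  obtain ⟨s, hs1, hgs⟩ := hs
  have h2 : ((-2 : ℤ) : ZMod p) ≠ 0 := by
    rw [Int.cast_neg, neg_ne_zero]
    have : ((2 : ℕ) : ZMod p) ≠ 0 := by
      rw [Ne, ZMod.natCast_eq_zero_iff, Nat.prime_dvd_prime_iff_eq hp Nat.prime_two]
      exact hp2
    exact_mod_cast this
  have hsl : s = legendreSym p (-2) := by
    have h3 := hC s hgs
    have h4 := legendreSym.eq_pow p (-2)
    have h5 := legendreSym.eq_one_or_neg_one p h2
    have h6 : (s : ZMod p) * (legendreSym p (-2) : ℤ) = 1 := by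
      rw [h4]; simpa using h3
    have hne : (-1 : ZMod p) ≠ 1 := by
      have : Fact (2 < p) := ⟨by have := hp.two_le; omega⟩
      exact ZMod.neg_one_ne_one
    rcases hs1 with h | h <;> rcases h5 with h' | h' <;> rw [h, h'] at h6 ⊢ <;> simp at h6 <;>
      exact absurd h6 hne
  rw [hgs, hpv, ← mul_assoc]
  congr 1
  rw [hsl, legendreSym.at_neg_two hp2, ZMod.χ₈'_nat_eq_if_mod_eight, epsFactor]
  have h8 : p % 8 = 1 ∨ p % 8 = 3 ∨ p % 8 = 5 ∨ p % 8 = 7 := by omega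
  have hI : ∀ n : ℕ, Complex.I ^ (4 * n) = 1 := fun n => by
    rw [pow_mul, Complex.I_pow_four, one_pow]
  rcases h8 with h | h | h | h
  · have e : p / 2 = 4 * (p / 8) := by omega
    have e4 : p % 4 = 1 := by omega
    rw [e, hI]; simp [h, e4, hodd]
  · have e : p / 2 = 4 * (p / 8) + 1 := by omega
    have e4 : p % 4 = 3 := by omega
    rw [e, pow_add, hI]; simp [h, e4, hodd]
  · have e : p / 2 = 4 * (p / 8) + 2 := by omega
    have e4 : p % 4 = 1 := by omega
    rw [e, pow_add, hI]; simp [h, e4, hodd]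
  · have e : p / 2 = 4 * (p / 8) + 3 := by omega
    have e4 : p % 4 = 3 := by omega
    rw [e, pow_add, hI]; simp [h, e4, hodd, Complex.I_pow_three]

lemma gaussSumG_eq (a b : ℤ) (N : ℕ) [NeZero N] :
    gaussSumG a b N = ∑ x : ZMod N, (ZMod.stdAddChar ((a : ZMod N) * x ^ 2 + (b : ZMod N) * x) : ℂ) := by
  rw [sumZ, gaussSumG]
  refine sum_congr rfl fun n _ => ?_
  have := ZMod.stdAddChar_coe (N := N) (a * n ^ 2 + b * n)
  push_cast at this ⊢
  rw [this]
  congr 1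
  ring

/-- the case of a prime modulus -/
lemma gauss_prime (p : ℕ) [Fact p.Prime] (hp2 : p ≠ 2) (a : ℤ) (ha : ¬ (p : ℤ) ∣ a) :
    gaussSumG a 0 p = legendreSym p a * (epsFactor p * (Real.sqrt p : ℂ)) := by
  have hp : p.Prime := Fact.out
  have hc : ringChar (ZMod p) ≠ 2 := by rwa [ZMod.ringChar_zmod_n]
  have ha0 : (a : ZMod p) ≠ 0 := by rwa [Ne, ZMod.intCast_zmod_eq_zero_iff_dvd]
  rw [← gval p hp2, gaussSumG_eq]
  have h1 : ∑ x : ZMod p, (ZMod.stdAddChar ((a : ZMod p) * x ^ 2 + ((0 : ℤ) : ZMod p) * x) : ℂ) =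
      ∑ y : ZMod p, ((quadraticChar (ZMod p) y : ℂ) + 1) * ZMod.stdAddChar ((a : ZMod p) * y) := by
    rw [← sum_fiberwise univ (fun x : ZMod p => x ^ 2)]
    refine sum_congr rfl fun y _ => ?_
    have h := quadraticChar_card_sqrts hc y
    have h' : ((#{x ∈ (univ : Finset (ZMod p)) | x ^ 2 = y} : ℕ) : ℂ) =
        (quadraticChar (ZMod p) y : ℂ) + 1 := by
      rw [← Int.cast_one, ← Int.cast_add, ← h, Int.cast_natCast]
      congr 2
      ext; simp
    rw [← h', ← nsmul_eq_mul, ← sum_const]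
    refine sum_congr rfl fun x hx => ?_
    simp at hx
    simp [hx]
  rw [h1]
  simp only [add_mul, one_mul, sum_add_distrib]
  have h2 : ∑ y : ZMod p, (ZMod.stdAddChar ((a : ZMod p) * y) : ℂ) = 0 := by
    have := AddChar.sum_mulShift (R := ZMod p) (a : ZMod p) (ZMod.isPrimitive_stdAddChar p)
    simp only [ha0, if_false] at this
    simpa [mul_comm] using this
  rw [h2, add_zero]
  have h3 := sumZ p (fun y => (quadraticChar (ZMod p) y : ℂ) * ZMod.stdAddChar y)
  have h4 : ∑ j ∈ range p, (legendreSym p j : ℂ) * (ZMod.stdAddChar (j : ZMod p) : ℂ) =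
    ∑ y : ZMod p, (quadraticChar (ZMod p) y : ℂ) * ZMod.stdAddChar y := by
    rw [h3]; simp [legendreSym]
  rw [h4, ← Equiv.sum_comp (Equiv.mulLeft₀ (a : ZMod p) ha0)
    (fun y => (quadraticChar (ZMod p) y : ℂ) * ZMod.stdAddChar y), mul_sum]
  refine sum_congr rfl fun y _ => ?_
  have h5 : (legendreSym p a : ℂ) * legendreSym p a = 1 := by
    have := legendreSym.sq_one p ha0
    rw [sq] at this
    exact_mod_cast this
  simp only [Equiv.mulLeft₀_apply, map_mul, Int.cast_mul]
  rw [show quadraticChar (ZMod p) (a : ZMod p) = legendreSym p a from rfl]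
  linear_combination -((quadraticChar (ZMod p) y : ℂ)) * ZMod.stdAddChar ((a : ZMod p) * y) * h5

lemma sum_split (A B : ℕ) (f : ℕ → ℂ) :
    ∑ n ∈ range (A * B), f n = ∑ u ∈ range A, ∑ v ∈ range B, f (u + A * v) := by
  rw [sum_comm]
  induction B with
  | zero => simp
  | succ B ih =>
    rw [Nat.mul_succ, sum_range_add, ih, sum_range_succ]
    congr 1
    exact sum_congr rfl fun u _ => by rw [add_comm]

lemma exp_int_add (N : ℕ) (hN : N ≠ 0) (j k : ℤ) :
    Complex.exp (2 * Real.pi * Complex.I * (((j + N * k : ℤ) : ℂ) / (N : ℂ))) =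
    Complex.exp (2 * Real.pi * Complex.I * ((j : ℂ) / (N : ℂ))) := by
  rw [Complex.exp_eq_exp_iff_exists_int]
  refine ⟨k, ?_⟩
  have : (N : ℂ) ≠ 0 := by exact_mod_cast hN
  push_cast
  field_simp

lemma gauss_rec (p : ℕ) [Fact p.Prime] (hp2 : p ≠ 2) (a : ℤ) (ha : ¬ (p : ℤ) ∣ a) (k : ℕ) :
    gaussSumG a 0 (p ^ (k + 2)) = p * gaussSumG a 0 (p ^ k) := by
  have hp : p.Prime := Fact.out
  have hp0 : (p : ℂ) ≠ 0 := by exact_mod_cast hp.ne_zero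
  have h2 : ((2 : ℕ) : ZMod p) ≠ 0 := by
    rw [Ne, ZMod.natCast_eq_zero_iff, Nat.prime_dvd_prime_iff_eq hp Nat.prime_two]
    exact hp2
  have ha0 : (a : ZMod p) ≠ 0 := by rwa [Ne, ZMod.intCast_zmod_eq_zero_iff_dvd]
  have hin : ∀ u : ℕ, ∑ v ∈ range p, Complex.exp (2 * Real.pi * Complex.I *
      (((a * ((u + p ^ (k + 1) * v : ℕ) : ℤ) ^ 2 + 0 * ((u + p ^ (k + 1) * v : ℕ) : ℤ) : ℤ) : ℂ) /
        ((p ^ (k + 2) : ℕ) : ℂ))) =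
      if p ∣ u then p * Complex.exp (2 * Real.pi * Complex.I * (((a * u ^ 2 : ℤ) : ℂ) /
        ((p ^ (k + 2) : ℕ) : ℂ))) else 0 := by
    intro u
    have h1 : ∀ v ∈ range p, Complex.exp (2 * Real.pi * Complex.I *
      (((a * ((u + p ^ (k + 1) * v : ℕ) : ℤ) ^ 2 + 0 * ((u + p ^ (k + 1) * v : ℕ) : ℤ) : ℤ) : ℂ) /
        ((p ^ (k + 2) : ℕ) : ℂ))) =
        Complex.exp (2 * Real.pi * Complex.I * (((a * u ^ 2 : ℤ) : ℂ) /
        ((p ^ (k + 2) : ℕ) : ℂ))) * ZMod.stdAddChar ((v : ZMod p) * (2 * a * u : ZMod p)) := by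
      intro v _
      have e1 : (a * ((u + p ^ (k + 1) * v : ℕ) : ℤ) ^ 2 + 0 * ((u + p ^ (k + 1) * v : ℕ) : ℤ) : ℤ)
        = (a * u ^ 2 + 2 * a * u * v * p ^ (k + 1)) + (p ^ (k + 2) : ℕ) * (a * v ^ 2 * p ^ k) := by
        push_cast
        ring
      have e2 := ZMod.stdAddChar_coe (N := p) (v * (2 * a * u))
      rw [e1, exp_int_add _ (pow_ne_zero _ hp.ne_zero)]
      push_cast at e2 ⊢
      rw [e2, ← Complex.exp_add]
      congr 1
      field_simp
      ring
    rw [sum_congr rfl h1, ← mul_sum, ← sumZ p (fun x => ZMod.stdAddChar (x * (2 * a * u : ZMod p))),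
      AddChar.sum_mulShift _ (ZMod.isPrimitive_stdAddChar p)]
    have h3 : (2 * a * u : ZMod p) = 0 ↔ p ∣ u := by
      rw [← ZMod.natCast_eq_zero_iff, mul_eq_zero, mul_eq_zero]
      have : (2 : ZMod p) ≠ 0 := by exact_mod_cast h2
      tauto
    simp only [h3, ZMod.card]
    split_ifs <;> push_cast <;> ring
  rw [gaussSumG, show p ^ (k + 2) = p ^ (k + 1) * p from rfl, sum_split]
  rw [show p ^ (k + 1) * p = p ^ (k + 2) from rfl, sum_congr rfl fun u _ => hin u]
  rw [pow_succ, mul_comm (p ^ k) p, sum_split, gaussSumG, mul_sum]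
  rw [sum_eq_single_of_mem 0 (by simp [hp.pos])]
  · refine sum_congr rfl fun w _ => ?_
    rw [if_pos (by simp)]
    congr 2
    have : ((p ^ k : ℕ) : ℂ) ≠ 0 := by exact_mod_cast pow_ne_zero _ hp.ne_zero
    push_cast
    field_simp
    ring
  · intro u hu hu0
    rw [mem_range] at hu
    refine sum_eq_zero fun w _ => if_neg ?_
    rw [Nat.dvd_add_left (dvd_mul_right _ _)]
    exact fun h => hu0 (Nat.eq_zero_of_dvd_of_lt h hu)

lemma gauss_pow (p : ℕ) [Fact p.Prime] (hp2 : p ≠ 2) (a : ℤ) (ha : ¬ (p : ℤ) ∣ a) (k : ℕ) :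
    gaussSumG a 0 (p ^ k) =
      (Real.sqrt p : ℂ) ^ k * epsFactor (p ^ k) * (jacobiSym a (p ^ k) : ℂ) := by
  have hp : p.Prime := Fact.out
  have hodd : p % 2 = 1 := hp.eq_two_or_odd.resolve_left hp2
  induction k using Nat.twoStepInduction with
  | zero => simp [gaussSumG, epsFactor]
  | one =>
    rw [pow_one, gauss_prime p hp2 a ha, jacobiSym.legendreSym.to_jacobiSym]
    ring
  | more k ih _ =>
    rw [gauss_rec p hp2 a ha, ih]
    have h1 : epsFactor (p ^ (k + 2)) = epsFactor (p ^ k) := by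
      have : p ^ 2 % 4 = 1 := by
        have : p % 4 = 1 ∨ p % 4 = 3 := by omega
        rcases this with h | h <;> simp [Nat.pow_mod, h]
      rw [epsFactor, epsFactor, pow_add, Nat.mul_mod, this, mul_one, Nat.mod_mod]
    have h2 : jacobiSym a (p ^ (k + 2)) = jacobiSym a (p ^ k) := by
      have : jacobiSym a p ^ 2 = 1 := by
        rw [← jacobiSym.legendreSym.to_jacobiSym]
        exact legendreSym.sq_one p (by rwa [Ne, ZMod.intCast_zmod_eq_zero_iff_dvd])
      rw [jacobiSym.pow_right, jacobiSym.pow_right, pow_add, this, mul_one]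
    have h3 : (Real.sqrt p : ℂ) ^ 2 = p := by
      have : Real.sqrt p ^ 2 = p := Real.sq_sqrt (by positivity)
      exact_mod_cast this
    rw [h1, h2, pow_add, h3]
    ring

lemma gauss_shift (N : ℕ) [NeZero N] (a b c : ℤ) (h : 4 * a * c ≡ 1 [ZMOD N]) :
    gaussSumG a b N = gaussSumG a 0 N *
      Complex.exp (-(2 * Real.pi * Complex.I) * (((b ^ 2 * c : ℤ) : ℂ) / (N : ℂ))) := by
  have h' : (4 * a * c : ZMod N) = 1 := by
    have := (ZMod.intCast_eq_intCast_iff _ _ _).2 h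
    push_cast at this
    exact this
  rw [gaussSumG_eq, gaussSumG_eq, ← Equiv.sum_comp (Equiv.subRight (2 * c * b : ZMod N)), sum_mul]
  refine sum_congr rfl fun x _ => ?_
  have h1 := ZMod.stdAddChar_coe (N := N) (-(b ^ 2 * c))
  have h2 : Complex.exp (-(2 * Real.pi * Complex.I) * (((b ^ 2 * c : ℤ) : ℂ) / (N : ℂ))) =
      (ZMod.stdAddChar (-(b ^ 2 * c) : ZMod N) : ℂ) := by
    push_cast at h1 ⊢
    rw [h1]
    congr 1
    ring
  rw [h2, ← AddChar.map_add_eq_mul]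
  congr 1
  simp only [Equiv.subRight_apply]
  push_cast
  linear_combination (-b * x + b ^ 2 * c) * h'

lemma gauss_scale (p : ℕ) (hp : p ≠ 0) (a b : ℤ) (α k : ℕ) :
    gaussSumG (p ^ α * a) (p ^ α * b) (p ^ (α + k)) = p ^ α * gaussSumG a b (p ^ k) := by
  have hp0 : (p : ℂ) ≠ 0 := by exact_mod_cast hp
  rw [gaussSumG, show p ^ (α + k) = p ^ k * p ^ α by ring, sum_split, gaussSumG, mul_sum]
  refine sum_congr rfl fun u _ => ?_
  have : ∀ v ∈ range (p ^ α), Complex.exp (2 * Real.pi * Complex.I * (((p ^ α * a *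
      ((u + p ^ k * v : ℕ) : ℤ) ^ 2 + p ^ α * b * ((u + p ^ k * v : ℕ) : ℤ) : ℤ) : ℂ) /
        ((p ^ k * p ^ α : ℕ) : ℂ))) =
      Complex.exp (2 * Real.pi * Complex.I * (((a * u ^ 2 + b * u : ℤ) : ℂ) /
        ((p ^ k : ℕ) : ℂ))) := by
    intro v _
    rw [← exp_int_add _ (pow_ne_zero k hp) _ (2 * a * u * v + a * p ^ k * v ^ 2 + b * v)]
    congr 1
    push_cast
    field_simp
    ring
  rw [sum_congr rfl this, sum_const, card_range, nsmul_eq_mul]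
  push_cast
  rfl

/-- Lemma 3.1 (2)(i): evaluation of `G(a,b;p^ν)` for an odd prime `p`, where
`α = ord_p(a) < ν` and `p^α ∣ b`; here `c₀` is any integer with
`4·(a/p^α)·c₀ ≡ 1 (mod p^{ν+α})`. -/
theorem gaussSum_eval_odd_prime (p : ℕ) (hp : p.Prime) (hodd : p ≠ 2) (ν : ℕ) (hν : 1 ≤ ν)
    (a : ℤ) (ha : a ≠ 0) (α : ℕ) (hα : α = padicValInt p a) (hαν : α < ν)
    (b : ℤ) (hb : (p : ℤ) ^ α ∣ b)
    (c₀ : ℤ) (hc₀ : 4 * (a / (p : ℤ) ^ α) * c₀ ≡ 1 [ZMOD ((p : ℤ) ^ (ν + α))]) :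
    gaussSumG a b (p ^ ν) =
      (p : ℂ) ^ (((α : ℂ) + (ν : ℂ)) / 2) * epsFactor (p ^ (ν - α)) *
        (jacobiSym (a / (p : ℤ) ^ α) (p ^ (ν - α)) : ℂ) *
        Complex.exp (-(2 * Real.pi * Complex.I) * (((b ^ 2 * c₀ : ℤ) : ℂ) / ((p : ℂ) ^ (ν + α)))) := by
  have : Fact p.Prime := ⟨hp⟩
  have hp0 : (p : ℂ) ≠ 0 := by exact_mod_cast hp.ne_zero
  have hpz : (p : ℤ) ^ α ≠ 0 := pow_ne_zero _ (by exact_mod_cast hp.ne_zero)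
  obtain ⟨k, rfl⟩ : ∃ k, ν = α + k := ⟨ν - α, by omega⟩
  obtain ⟨b', rfl⟩ := hb
  have hda : (p : ℤ) ^ α ∣ a := (padicValInt_dvd_iff α a).2 (Or.inr hα.le)
  have hnd : ¬ (p : ℤ) ^ (α + 1) ∣ a := by
    rw [padicValInt_dvd_iff]
    omega
  obtain ⟨a', rfl⟩ := hda
  rw [Int.mul_ediv_cancel_left _ hpz] at hc₀ ⊢
  have ha' : ¬ (p : ℤ) ∣ a' := by
    intro h
    apply hnd
    rw [pow_succ]
    exact mul_dvd_mul_left _ h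
  have hc : 4 * a' * c₀ ≡ 1 [ZMOD ((p ^ k : ℕ) : ℤ)] := by
    refine hc₀.of_dvd ?_
    push_cast
    exact pow_dvd_pow _ (by omega)
  have : NeZero (p ^ k) := ⟨pow_ne_zero _ hp.ne_zero⟩
  rw [gauss_scale p hp.ne_zero, gauss_shift _ a' b' c₀ hc, gauss_pow p hodd a' ha',
    Nat.add_sub_cancel_left]
  have h1 : (p : ℂ) ^ (((α : ℂ) + ((α + k : ℕ) : ℂ)) / 2) = p ^ α * (Real.sqrt p : ℂ) ^ k := by
    have e : ((α : ℂ) + ((α + k : ℕ) : ℂ)) / 2 = (α : ℂ) + (k : ℂ) * (1 / 2 : ℂ) := by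
      push_cast; ring
    rw [e, Complex.cpow_add _ _ hp0, Complex.cpow_natCast, Complex.cpow_nat_mul,
      Real.sqrt_eq_rpow, Complex.ofReal_cpow (by positivity)]
    simp
  have h2 : (((((p : ℤ) ^ α * b') ^ 2 * c₀ : ℤ) : ℂ) / ((p : ℂ) ^ (α + k + α))) =
      ((b' ^ 2 * c₀ : ℤ) : ℂ) / ((p ^ k : ℕ) : ℂ) := by
    push_cast
    field_simp
    ring
  rw [h1, h2]
  ring
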